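/- arXiv:2307.08784 — 2 statements merged into one kernel-verified Lean document; each statement's English description precedes it below -/
import Mathlib

section
/- There exists a simple 2-(81,6,2) design; that is, there exists a set 𝓑 of 6-element subsets of an 81-element set V such that every 2-element subset of V is contained in exactly 2 members of 𝓑. -/
/-!
# A simple 2-(81, 6, 2) design

The points are the `2 × 2` matrices over `𝔽₃`, and every block is a union of two parallel lines.
The directions of the lines are the sixteen points `⟨a bᵀ⟩` of the hyperbolic quadric `det = 0` of
`PG(3, 3)`. To each of them we attach one of the two tangent lines of the quadric there, chosen such
that every point off the quadric lies on exactly two of the chosen tangents.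
-/

namespace QuadricDesign

open scoped Pointwise

/-- The affine plane over `𝔽₃`. -/
abbrev Plane : Type := ZMod 3 × ZMod 3

/-- The `2 × 2` matrices over `𝔽₃`, listed by rows. -/
abbrev Point : Type := Plane × Plane

/-- The matrix `a bᵀ`. -/
def outer (a b : Plane) : Point := ((a.1 * b.1, a.1 * b.2), (a.2 * b.1, a.2 * b.2))

/-- Rotation by a right angle. -/
def rot (a : Plane) : Plane := (-a.2, a.1)

/-- The common direction of the two lines forming a block. -/
def direction (p : Plane × Plane) : Point := outer p.1 p.2

/-- The difference of the two lines forming a block. It spans, together with `direction p`, the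
chosen tangent line at `direction p`. -/
def offset (p : Plane × Plane) : Point :=
  outer p.1 (rot p.2) + (p.1.1 ^ 2 + p.1.2 ^ 2) • outer (rot p.1) p.2

/-- The block formed by the line through `0` and its translate by `offset p`. -/
def baseBlock (p : Plane × Plane) : Finset Point :=
  {0, direction p, -direction p,
    offset p, offset p + direction p, offset p - direction p}

/-- Representatives of the pairs of nonzero vectors modulo simultaneous change of sign. -/
def flags : Finset (Plane × Plane) :=
  {(1, 0), (0, 1), (1, 1), (1, 2)} ×ˢ {0}ᶜ

/-- All translates of the base blocks. -/
def blocks : Finset (Finset Point) :=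
  ((Finset.univ : Finset Point) ×ˢ flags).image fun q => q.1 +ᵥ baseBlock q.2

theorem mem_blocks {B : Finset Point} :
    B ∈ blocks ↔ ∃ z : Point, ∃ p ∈ flags, z +ᵥ baseBlock p = B := by
  simp only [blocks, Finset.mem_image, Finset.mem_product, Finset.mem_univ, true_and]
  exact ⟨fun ⟨q, hq, h⟩ => ⟨q.1, q.2, hq, h⟩, fun ⟨z, p, hp, h⟩ => ⟨(z, p), hp, h⟩⟩

attribute [irreducible] blocks

theorem card_baseBlock : ∀ p ∈ flags, (baseBlock p).card = 6 := by
  decide +kernel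

theorem zero_mem_baseBlock (p : Plane × Plane) : 0 ∈ baseBlock p := by
  simp [baseBlock]

theorem neg_vadd_baseBlock : ∀ p ∈ flags, ∀ c ∈ baseBlock p,
    ∃ q ∈ flags, -c +ᵥ baseBlock p = baseBlock q := by
  have h : ∀ p ∈ flags, (p.1, -p.2) ∈ flags ∧ ∀ c ∈ baseBlock p,
      -c +ᵥ baseBlock p = baseBlock p ∨ -c +ᵥ baseBlock p = baseBlock (p.1, -p.2) := by
    decide +kernel
  intro p hp c hc
  obtain ⟨hneg, h⟩ := h p hp
  rcases h c hc with h | h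
  exacts [⟨p, hp, h⟩, ⟨_, hneg, h⟩]

theorem baseBlock_injOn : Set.InjOn baseBlock flags := by
  have h : ∀ p ∈ flags, ∀ q ∈ flags,
      direction p ∈ baseBlock q → offset p ∈ baseBlock q → p = q := by
    decide +kernel
  intro p hp q hq hpq
  apply h p hp q hq <;> rw [← hpq] <;> simp [baseBlock]

theorem card_flags_through : ∀ w : Point, w ≠ 0 →
    (flags.filter fun p => w ∈ baseBlock p).card = 2 := by
  decide +kernel

theorem mem_vadd_iff (x y : Point) (s : Finset Point) : y ∈ x +ᵥ s ↔ y - x ∈ s := by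
  rw [← Finset.neg_vadd_mem_iff, vadd_eq_add, neg_add_eq_sub]

theorem mem_blocks_and_mem_iff (x : Point) (B : Finset Point) :
    B ∈ blocks ∧ x ∈ B ↔ ∃ p ∈ flags, x +ᵥ baseBlock p = B := by
  constructor
  · rintro ⟨hB, hx⟩
    obtain ⟨z, p, hp, rfl⟩ := mem_blocks.1 hB
    obtain ⟨q, hq, h⟩ := neg_vadd_baseBlock p hp _
      ((mem_vadd_iff z x _).1 hx)
    refine ⟨q, hq, ?_⟩
    rw [← h, vadd_vadd]
    congr 1
    abel
  · rintro ⟨p, hp, rfl⟩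
    refine ⟨mem_blocks.2 ⟨x, p, hp, rfl⟩, ?_⟩
    simpa [mem_vadd_iff] using zero_mem_baseBlock p

theorem card_of_mem_blocks {B : Finset Point} (hB : B ∈ blocks) : B.card = 6 := by
  obtain ⟨z, p, hp, rfl⟩ := mem_blocks.1 hB
  rw [Finset.card_vadd_finset]
  exact card_baseBlock p hp

theorem ncard_blocks_through {x y : Point} (hxy : x ≠ y) :
    {B : Finset Point | B ∈ blocks ∧ {x, y} ⊆ B}.ncard = 2 := by
  have h : {B : Finset Point | B ∈ blocks ∧ {x, y} ⊆ B} =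
      ((flags.filter fun p => y - x ∈ baseBlock p).image fun p => x +ᵥ baseBlock p :
        Finset (Finset Point)) := by
    ext B
    simp only [Set.mem_ofPred_eq, Finset.insert_subset_iff, Finset.singleton_subset_iff,
      ← and_assoc, mem_blocks_and_mem_iff, Finset.coe_image, Set.mem_image, Finset.mem_coe,
      Finset.mem_filter]
    constructor
    · rintro ⟨⟨p, hp, rfl⟩, hy⟩
      exact ⟨p, ⟨hp, (mem_vadd_iff x y _).1 hy⟩, rfl⟩
    · rintro ⟨p, ⟨hp, hy⟩, rfl⟩
      exact ⟨⟨p, hp, rfl⟩, (mem_vadd_iff x y _).2 hy⟩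
  rw [h, Set.ncard_coe_finset, Finset.card_image_of_injOn,
    card_flags_through _ (sub_ne_zero.2 hxy.symm)]
  intro p hp q hq hpq
  exact baseBlock_injOn (Finset.mem_filter.1 hp).1 (Finset.mem_filter.1 hq).1
    (vadd_left_cancel x hpq)

end QuadricDesign

/-- There exists a simple 2-(81,6,2) design: a set `𝓑` (a `Finset`, hence with pairwise
distinct members) of 6-element subsets of an 81-element set `V` such that every
2-element subset of `V` is contained in exactly 2 members of `𝓑`. -/
theorem exists_simple_design_81_6_2 :
    ∃ (V : Type) (_ : Fintype V) (𝓑 : Finset (Finset V)),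
      Fintype.card V = 81 ∧
      (∀ B ∈ 𝓑, B.card = 6) ∧
      (∀ T : Finset V, T.card = 2 →
        ({B : Finset V | B ∈ 𝓑 ∧ T ⊆ B}).ncard = 2) := by
  refine ⟨QuadricDesign.Point, inferInstance, QuadricDesign.blocks, by simp [ZMod.card],
    fun B hB => QuadricDesign.card_of_mem_blocks hB, fun T hT => ?_⟩
  obtain ⟨x, y, hxy, rfl⟩ := Finset.card_eq_two.1 hT
  exact QuadricDesign.ncard_blocks_through hxy
end

section
/- There exists a set 𝓑 of 6-element subsets of G = (ZMod 3)^4 such that: (i) every 2-element subset of G is contained in exactly 2 members of 𝓑; and (ii) every member of 𝓑 is the union of two disjoint parallel lines of AG(4,3), i.e. of the form {p, p+x, p+2x} ∪ {q, q+x, q+2x} for some x ≠ 0 with the two lines disjoint. In particular there exists a simple, strictly additive 2-(81,6,2) design whose points are the elements of the elementary abelian group of order 81. -/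
/-- The elementary abelian group of order 81, i.e. the point set of AG(4,3). -/
abbrev G : Type := Fin 4 → ZMod 3

/-- The line of AG(4,3) through `p` with direction `x`: the set `{p, p + x, p + 2x}`. -/
def line (p x : G) : Finset G := {p, p + x, p + x + x}

open scoped Pointwise

theorem vadd_line (a p x : G) : a +ᵥ line p x = line (a + p) x := by
  simp [line, Finset.vadd_finset_insert, add_assoc]

theorem add_add_self_eq_zero (x : G) : x + x + x = 0 := by
  funext i
  exact (by decide : ∀ t : ZMod 3, t + t + t = 0) (x i)

theorem mem_line_self (p x : G) : p ∈ line p x := by simp [line]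

theorem line_eq_of_mem {a p x : G} (h : a ∈ line p x) : line p x = line a x := by
  have hx := add_add_self_eq_zero x
  have h₁ : p + x + x + x = p := by rw [add_assoc, add_assoc, ← add_assoc x, hx, add_zero]
  simp only [line, Finset.mem_insert, Finset.mem_singleton] at h
  ext b
  rcases h with rfl | rfl | rfl <;> simp only [line, Finset.mem_insert, Finset.mem_singleton, h₁] <;>
    tauto

theorem card_line {x : G} (hx : x ≠ 0) (p : G) : (line p x).card = 3 := by
  have h : x + x ≠ 0 := fun h => hx (by simpa [h] using add_add_self_eq_zero x)
  exact Finset.card_eq_three.2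
    ⟨p, p + x, p + x + x, by simpa using hx, by simpa [add_assoc] using h, by simpa using hx, rfl⟩

theorem sum_line {x : G} (hx : x ≠ 0) (p : G) : ∑ y ∈ line p x, y = 0 := by
  have h : x + x ≠ 0 := fun h => hx (by simpa [h] using add_add_self_eq_zero x)
  rw [line, Finset.sum_insert (by simpa [add_assoc] using ⟨hx, h⟩),
    Finset.sum_pair (by simpa using hx)]
  calc p + (p + x + (p + x + x)) = (p + p + p) + (x + x + x) := by abel
    _ = 0 := by simp [add_add_self_eq_zero]

/-- Representatives of the four points of the projective line over `ZMod 3`. -/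
def projPoint : Fin 4 → ZMod 3 × ZMod 3 := ![(0, 1), (1, 0), (1, 1), (1, 2)]

/-- The tensor `u ⊗ v`, written in coordinates. -/
def tensor (u v : ZMod 3 × ZMod 3) : G := ![u.1 * v.1, u.1 * v.2, u.2 * v.1, u.2 * v.2]

/-- Rotation by a quarter turn; it has no eigenvector over `ZMod 3`. -/
def rot (u : ZMod 3 × ZMod 3) : ZMod 3 × ZMod 3 := (-u.2, u.1)

/-- The sixteen points `u ⊗ v` of the hyperbolic quadric in PG(3,3). -/
def dir (i : Fin 4 × Fin 4) : G := tensor (projPoint i.1) (projPoint i.2)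

/-- A second point on a tangent line to the quadric at `dir i`. The sixteen tangents so obtained
cover each point off the quadric exactly twice. -/
def offset (i : Fin 4 × Fin 4) : G :=
  let u := projPoint i.1
  let v := projPoint i.2
  tensor u (rot v) + (v.1 ^ 2 + v.2 ^ 2) • tensor (rot u) v

/-- The union of the lines with direction `dir i` through `p` and `p + offset i`. -/
def block (i : Fin 4 × Fin 4) (p : G) : Finset G := line p (dir i) ∪ line (p + offset i) (dir i)

theorem vadd_block (a p : G) (i : Fin 4 × Fin 4) : a +ᵥ block i p = block i (a + p) := by
  simp [block, Finset.vadd_finset_union, vadd_line, add_assoc]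

theorem dir_ne_zero : ∀ i, dir i ≠ 0 := by decide +kernel

theorem disjoint_zero : ∀ i, Disjoint (line 0 (dir i)) (line (0 + offset i) (dir i)) := by
  decide +kernel

theorem disjoint_block (i : Fin 4 × Fin 4) (p : G) :
    Disjoint (line p (dir i)) (line (p + offset i) (dir i)) := by
  have h := (Finset.disjoint_image (add_right_injective p)).2 (disjoint_zero i)
  rw [zero_add] at h
  change Disjoint (p +ᵥ line 0 (dir i)) (p +ᵥ line (offset i) (dir i)) at h
  simpa only [vadd_line, add_zero] using h

/-- The blocks through `a`: in `through a (i, b)`, the point `a` lies on the first line if `b` is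
`false` and on the second if `b` is `true`. -/
def through (a : G) (m : (Fin 4 × Fin 4) × Bool) : Finset G :=
  block m.1 (a + cond m.2 (-offset m.1) 0)

theorem through_eq_vadd (a : G) (m : (Fin 4 × Fin 4) × Bool) :
    through a m = a +ᵥ through 0 m := by
  simp [through, vadd_block]

theorem mem_through_self (a : G) (m : (Fin 4 × Fin 4) × Bool) : a ∈ through a m := by
  rcases m with ⟨i, _ | _⟩ <;> simp [through, block, mem_line_self]

theorem exists_eq_through {a p : G} {i : Fin 4 × Fin 4} (h : a ∈ block i p) :
    ∃ m, through a m = block i p := by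
  rcases Finset.mem_union.1 h with h | h
  · refine ⟨(i, false), ?_⟩
    have h₁ : a + offset i ∈ line (p + offset i) (dir i) := by
      rw [add_comm a, add_comm p, ← vadd_line]
      exact Finset.vadd_mem_vadd_finset h
    simp [through, block, line_eq_of_mem h, line_eq_of_mem h₁]
  · refine ⟨(i, true), ?_⟩
    have h₁ : a + -offset i ∈ line p (dir i) := by
      rw [add_comm a, ← neg_add_cancel_left (offset i) p, ← vadd_line, add_comm (offset i)]
      exact Finset.vadd_mem_vadd_finset h
    simp [through, block, line_eq_of_mem h, line_eq_of_mem h₁]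

theorem through_zero_injective : Function.Injective (through 0) := by
  have h : ∀ m n, through 0 m ⊆ through 0 n → m = n := by decide +kernel
  exact fun m n e => h m n e.subset

theorem through_injective (a : G) : Function.Injective (through a) := fun m n h =>
  through_zero_injective (AddAction.injective a (by simpa only [through_eq_vadd a] using h))

theorem card_filter_mem_through_zero : ∀ d : G, d ≠ 0 →
    (Finset.univ.filter fun m => d ∈ through 0 m).card = 2 := by
  decide +kernel

theorem card_filter_mem_through {a b : G} (h : a ≠ b) :
    (Finset.univ.filter fun m => b ∈ through a m).card = 2 := by
  rw [← card_filter_mem_through_zero (-a + b) (by simpa [neg_add_eq_zero] using h)]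
  congr 1
  ext m
  rw [Finset.mem_filter, Finset.mem_filter, through_eq_vadd, ← Finset.neg_vadd_mem_iff, vadd_eq_add]

/-- There exists a set `𝓑` of 6-element subsets of `G = (ZMod 3)^4` such that every
2-element subset of `G` is contained in exactly 2 members of `𝓑`, and every member of `𝓑`
is the union of two disjoint parallel lines of AG(4,3).  In particular (each block summing
to zero) there is a simple, strictly additive 2-(81,6,2) design whose points are the
elements of the elementary abelian group of order 81. -/
theorem exists_simple_strictly_additive_design_81_6_2 :
    ∃ 𝓑 : Finset (Finset G),
      (∀ B ∈ 𝓑, B.card = 6) ∧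
      (∀ T : Finset G, T.card = 2 → (𝓑.filter (fun B => T ⊆ B)).card = 2) ∧
      (∀ B ∈ 𝓑, ∃ (x p q : G), x ≠ 0 ∧
        Disjoint (line p x) (line q x) ∧ B = line p x ∪ line q x) ∧
      (∀ B ∈ 𝓑, ∑ x ∈ B, x = (0 : G)) := by
  refine ⟨Finset.univ.image fun m : (Fin 4 × Fin 4) × G => block m.1 m.2, ?_, ?_, ?_, ?_⟩
  · intro B hB
    obtain ⟨⟨i, p⟩, -, rfl⟩ := Finset.mem_image.1 hB
    simp [block, Finset.card_union_of_disjoint (disjoint_block i p), card_line (dir_ne_zero i)]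
  · intro T hT
    obtain ⟨a, b, hab, rfl⟩ := Finset.card_eq_two.1 hT
    refine Eq.trans ?_ (card_filter_mem_through hab)
    rw [← Finset.card_image_of_injective _ (through_injective a)]
    refine congrArg Finset.card (Finset.ext fun B => ?_)
    simp only [Finset.mem_filter, Finset.mem_image, Finset.mem_univ, true_and,
      Finset.insert_subset_iff, Finset.singleton_subset_iff]
    constructor
    · rintro ⟨⟨⟨i, p⟩, rfl⟩, ha, hb⟩
      obtain ⟨m, hm⟩ := exists_eq_through ha
      exact ⟨m, hm ▸ hb, hm⟩
    · rintro ⟨m, hb, rfl⟩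
      exact ⟨⟨(m.1, _), rfl⟩, mem_through_self a m, hb⟩
  · intro B hB
    obtain ⟨⟨i, p⟩, -, rfl⟩ := Finset.mem_image.1 hB
    exact ⟨dir i, p, p + offset i, dir_ne_zero i, disjoint_block i p, rfl⟩
  · intro B hB
    obtain ⟨⟨i, p⟩, -, rfl⟩ := Finset.mem_image.1 hB
    simp [block, Finset.sum_union (disjoint_block i p), sum_line (dir_ne_zero i)]
end
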